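/- (Discrete-time first integral preservation, Theorem 2.) Let V₁, …, V_K : ℝ^N → ℝ and let ∇̄V_k : ℝ^N × ℝ^N → ℝ^N satisfy the discrete chain rule V_k(v) − V_k(u) = ⟨∇̄V_k(v, u), v − u⟩ for all u, v ∈ ℝ^N and all k. Let u⁰, u¹ ∈ ℝ^N, Δt > 0, and ψ̂ ∈ ℝ^N. Let M̄ be the K × N matrix with rows ∇̄V_k(u¹, u⁰), assume M̄ M̄ᵀ is invertible, and set Ȳ = M̄ᵀ (M̄ M̄ᵀ)⁻¹ M̄. If (u¹ − u⁰)/Δt = (I − Ȳ) ψ̂, then V_k(u¹) = V_k(u⁰) for every k = 1, …, K. -/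

import Mathlib

open Matrix

theorem Matrix.mul_one_sub_transpose_mul_inv_mul {m n R : Type*} [Fintype m] [DecidableEq m]
    [Fintype n] [DecidableEq n] [CommRing R] (M : Matrix m n R) (hM : IsUnit (M * Mᵀ)) :
    M * (1 - Mᵀ * (M * Mᵀ)⁻¹ * M) = 0 := by
  rw [Matrix.mul_sub, Matrix.mul_one, ← Matrix.mul_assoc, ← Matrix.mul_assoc,
    Matrix.mul_nonsing_inv _ ((Matrix.isUnit_iff_isUnit_det _).1 hM), Matrix.one_mul, sub_self]

theorem stmt_2 {K N : ℕ}
    (V : Fin K → (Fin N → ℝ) → ℝ)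
    (dg : Fin K → (Fin N → ℝ) → (Fin N → ℝ) → (Fin N → ℝ))
    (hdg : ∀ k (v u : Fin N → ℝ), V k v - V k u = ∑ i, dg k v u i * (v i - u i))
    (u0 u1 : Fin N → ℝ) (Δt : ℝ) (hΔt : 0 < Δt) (ψ : Fin N → ℝ)
    (M : Matrix (Fin K) (Fin N) ℝ) (hM : ∀ k i, M k i = dg k u1 u0 i)
    (hinv : IsUnit (M * Mᵀ))
    (hupd : (fun i => (u1 i - u0 i) / Δt) =
      (1 - Mᵀ * (M * Mᵀ)⁻¹ * M).mulVec ψ) :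
    ∀ k, V k u1 = V k u0 := by
  intro k
  have h : M.mulVec (fun i => (u1 i - u0 i) / Δt) = 0 := by
    rw [hupd, mulVec_mulVec, mul_one_sub_transpose_mul_inv_mul M hinv, zero_mulVec]
  have hk := congrFun h k
  simp only [mulVec, dotProduct, hM, ← mul_div_assoc, ← Finset.sum_div, Pi.zero_apply,
    div_eq_zero_iff, hΔt.ne', or_false] at hk
  rw [← sub_eq_zero, hdg, hk]
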